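/- Let K be a field, let m ≥ 2 and 1 ≤ s < m, and let ℓ = (ℓ_1,…,ℓ_m) be a vector of integers with ℓ_1,…,ℓ_s even and at least 2 and ℓ_{s+1},…,ℓ_m odd and at least 3. Let G = G_ℓ be the multi-path graph, let G₁ be the subgraph of G formed by the union of the s paths of even length (together with v1 and v2) and let G₂ be the subgraph formed by the union of the m−s paths of odd length (together with v1 and v2). Then the toric ideal I_G of G equals the sum of the extensions of the toric ideals I_{G₁} and I_{G₂} along the inclusions of polynomial rings K[E(G₁)] ⊆ K[E(G)] and K[E(G₂)] ⊆ K[E(G)]; consequently the edge ring K[G] is isomorphic as a K-algebra to the tensor product K[G₁] ⊗_K K[G₂]. -/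

import Mathlib

open CategoryTheory MvPolynomial Finset
open scoped Classical

noncomputable section

namespace Paper

/-- The monomial `x_u * x_v` associated to an unordered pair `{u, v}` of vertices. -/
def edgeMon (K : Type*) [CommRing K] {V : Type*} (e : Sym2 V) : MvPolynomial V K :=
  Sym2.lift ⟨fun u v => X u * X v, fun u v => mul_comm _ _⟩ e

/-- The `K`-algebra map `K[E(G)] → K[V(G)]` sending the variable of an edge `{u,v}` to
`x_u * x_v`. -/
def edgeHom (K : Type*) [CommRing K] {V : Type*} (G : SimpleGraph V) :
    MvPolynomial G.edgeSet K →ₐ[K] MvPolynomial V K :=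
  aeval (fun e => edgeMon K (e : Sym2 V))

/-- The toric ideal of a simple graph. -/
def toricIdeal (K : Type*) [CommRing K] {V : Type*} (G : SimpleGraph V) :
    Ideal (MvPolynomial G.edgeSet K) :=
  RingHom.ker (edgeHom K G).toRingHom

/-- The edge ring `K[G] = K[E(G)]/I_G`. -/
abbrev edgeRing (K : Type*) [CommRing K] {V : Type*} (G : SimpleGraph V) :=
  MvPolynomial G.edgeSet K ⧸ toricIdeal K G

open CategoryTheory.Limits in
/-- The projective dimension of a module, as an element of `ℕ∞`:  the least `n` such that `M`
admits a projective resolution vanishing in homological degrees `> n` (or `⊤` if there is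
no such finite resolution). -/
def projDim (R : Type*) [CommRing R] (M : ModuleCat R) : ℕ∞ :=
  sInf {n : ℕ∞ | ∃ m : ℕ, (m : ℕ∞) = n ∧
    ∃ P : ProjectiveResolution M, ∀ i : ℕ, m < i → IsZero (P.complex.X i)}

/-- The 0-1 vector `ε_u + ε_v` attached to an unordered pair `{u,v}` with `u ≠ v`. -/
def edgeVec {V : Type*} (e : Sym2 V) : V → ℝ :=
  fun v => if v ∈ e then 1 else 0

/-- The edge cone of a finite simple graph: all nonnegative real combinations of the vectors
`v_e = ε_u + ε_v`, for `e = {u,v}` an edge of `G`. -/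
def edgeCone {V : Type*} [Fintype V] (G : SimpleGraph V) : Set (V → ℝ) :=
  {x | ∃ a : Sym2 V → ℝ, (∀ e, 0 ≤ a e) ∧ (∀ e, e ∉ G.edgeSet → a e = 0) ∧
    x = ∑ e : Sym2 V, a e • edgeVec e}

/-- A vector has integer coordinates. -/
def IsIntegralVec {V : Type*} (x : V → ℝ) : Prop := ∀ v, ∃ n : ℤ, x v = n

/-- A minimal vector of `relint(ℝ₊(G)) ∩ ℤ^{V(G)}`. -/
def IsMinimalVec {V : Type*} [Fintype V] (G : SimpleGraph V) (x : V → ℝ) : Prop :=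
  x ∈ intrinsicInterior ℝ (edgeCone G) ∧ IsIntegralVec x ∧
    ¬ ∃ y z : V → ℝ, (y ∈ intrinsicInterior ℝ (edgeCone G) ∧ IsIntegralVec y) ∧
      (z ∈ edgeCone G ∧ IsIntegralVec z ∧ z ≠ 0) ∧ x = y + z

/-! ### Multi-path graphs.  `c i` is the number of interior vertices of the `i`-th path,
so the `i`-th path has length `c i + 1`. -/

/-- Vertices of the multi-path graph: `Sum.inl 0 = v1`, `Sum.inl 1 = v2`, and
`Sum.inr ⟨i, j⟩ = u_{i,j+1}`, the `(j+1)`-st interior vertex of the `i`-th path. -/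
abbrev MPV {m : ℕ} (c : Fin m → ℕ) : Type := Fin 2 ⊕ (Σ i : Fin m, Fin (c i))

def mpRel {m : ℕ} (c : Fin m → ℕ) : MPV c → MPV c → Prop
  | Sum.inl a, Sum.inr ⟨i, j⟩ => (a = 0 ∧ (j : ℕ) = 0) ∨ (a = 1 ∧ (j : ℕ) + 1 = c i)
  | Sum.inr ⟨i, j⟩, Sum.inr ⟨i', j'⟩ => (i : ℕ) = i' ∧ (j' : ℕ) = (j : ℕ) + 1
  | _, _ => False

/-- The multi-path graph with `m` paths, the `i`-th of which has `c i` interior vertices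
(hence length `c i + 1`), all starting at `v1 = Sum.inl 0` and ending at `v2 = Sum.inl 1`. -/
def multiPath {m : ℕ} (c : Fin m → ℕ) : SimpleGraph (MPV c) :=
  SimpleGraph.fromRel (mpRel c)

/-! ### The two-ear graph `G_m` and the one-ear graph `P_m`. -/

/-- Vertices of the two-ear graph:  `Sum.inl 0 = v1`, `Sum.inl 1 = v2`, `Sum.inl 2 = x1`,
`Sum.inl 3 = x2`, `Sum.inl 4 = y1`, `Sum.inl 5 = y2`, and `Sum.inr i = u_{i+1}`. -/
abbrev TEV (m : ℕ) : Type := Fin 6 ⊕ Fin (m - 1)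

def teRel (m : ℕ) : TEV m → TEV m → Prop
  | Sum.inl a, Sum.inl b =>
      (a = 0 ∧ b = 2) ∨ (a = 0 ∧ b = 3) ∨ (a = 2 ∧ b = 3) ∨ (a = 1 ∧ b = 4) ∨
      (a = 1 ∧ b = 5) ∨ (a = 4 ∧ b = 5) ∨ (a = 2 ∧ b = 4)
  | Sum.inl a, Sum.inr _ => a = 0 ∨ a = 1
  | _, _ => False

/-- The two-ear graph `𝐆_m`. -/
def twoEar (m : ℕ) : SimpleGraph (TEV m) := SimpleGraph.fromRel (teRel m)

/-- The one-ear graph `𝐏_m`, the induced subgraph of `𝐆_m` on the complement of `x2`. -/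
def oneEar (m : ℕ) : SimpleGraph ({v : TEV m | v ≠ Sum.inl 3} : Set (TEV m)) :=
  (twoEar m).induce {v : TEV m | v ≠ Sum.inl 3}

/-! ### Cycles, the odd-cycle condition, and compact graphs. -/

/-- The odd-cycle condition: any two vertex-disjoint odd cycles are joined by an edge. -/
def OddCycleCondition {V : Type*} (G : SimpleGraph V) : Prop :=
  ∀ (a b : V) (c₁ : G.Walk a a) (c₂ : G.Walk b b), c₁.IsCycle → c₂.IsCycle →
    Odd c₁.length → Odd c₂.length →
    (∀ x, x ∈ c₁.support → x ∉ c₂.support) →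
    ∃ x ∈ c₁.support, ∃ y ∈ c₂.support, G.Adj x y

/-- `G` has no even cycle. -/
def HasNoEvenCycle {V : Type*} (G : SimpleGraph V) : Prop :=
  ∀ (a : V) (c : G.Walk a a), c.IsCycle → ¬ Even c.length

/-- A compact graph: connected, all degrees at least `2`, no even cycle, and the
odd-cycle condition holds. -/
def IsCompactGraph {V : Type*} (G : SimpleGraph V) : Prop :=
  G.Connected ∧ (∀ v : V, 2 ≤ (G.neighborSet v).ncard) ∧ HasNoEvenCycle G ∧ OddCycleCondition G

/-- The number `t(G)` of minimal (= induced) cycles of `G`, counted via their vertex sets. -/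
def cycleCount {V : Type*} (G : SimpleGraph V) : ℕ :=
  Set.ncard {S : Set V | ∃ (a : V) (c : G.Walk a a), c.IsCycle ∧
    (∀ x y, x ∈ c.support → y ∈ c.support → G.Adj x y → s(x, y) ∈ c.edges) ∧
    S = {x | x ∈ c.support}}


/-- exponent vector of an edge -/
def edgeExp {V : Type*} (e : Sym2 V) : V →₀ ℕ :=
  Sym2.lift ⟨fun u v => Finsupp.single u 1 + Finsupp.single v 1, fun u v => add_comm _ _⟩ e

lemma edgeMon_eq (K : Type*) [CommRing K] {V : Type*} (e : Sym2 V) :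
    edgeMon K e = monomial (edgeExp e) 1 := by
  induction e using Sym2.ind with
  | _ u v => simp [edgeMon, edgeExp, X, monomial_mul]

/-- degree map -/
def degMap {V : Type*} (G : SimpleGraph V) : (G.edgeSet →₀ ℕ) →+ (V →₀ ℕ) :=
  (Finsupp.linearCombination ℕ (fun e : G.edgeSet => edgeExp (e : Sym2 V))).toAddMonoidHom

lemma degMap_single {V : Type*} (G : SimpleGraph V) (e : G.edgeSet) (n : ℕ) :
    degMap G (Finsupp.single e n) = n • edgeExp (e : Sym2 V) := by
  simp [degMap]

lemma edgeHom_monomial (K : Type*) [CommRing K] {V : Type*} (G : SimpleGraph V)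
    (a : G.edgeSet →₀ ℕ) : edgeHom K G (monomial a 1) = monomial (degMap G a) 1 := by
  induction a using Finsupp.induction_linear with
  | zero => simp only [map_zero]; exact map_one _
  | add f g hf hg =>
    rw [← one_mul (1 : K), ← monomial_mul, map_mul, hf, hg, monomial_mul, map_add]
  | single e n =>
    rw [degMap_single, edgeHom, aeval_monomial, Finsupp.prod_single_index (by simp), edgeMon_eq,
      monomial_pow]
    simp

/-- weight functional -/
def wt {V : Type*} (w : V → ℤ) : (V →₀ ℕ) →+ ℤ :=
  Finsupp.liftAddHom (fun v => (AddMonoidHom.mulLeft (w v)).comp (Nat.castAddMonoidHom ℤ))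

lemma wt_single {V : Type*} (w : V → ℤ) (v : V) (n : ℕ) :
    wt w (Finsupp.single v n) = w v * n := by
  simp [wt]

lemma wt_degMap {V : Type*} (G : SimpleGraph V) (w : V → ℤ)
    (hw : ∀ u v, G.Adj u v → w u + w v = 0) (a : G.edgeSet →₀ ℕ) :
    wt w (degMap G a) = 0 := by
  induction a using Finsupp.induction_linear with
  | zero => simp
  | add f g hf hg => simp [hf, hg]
  | single e n =>
    rw [degMap_single, map_nsmul]
    obtain ⟨e, he⟩ := e
    induction e using Sym2.ind with
    | _ u v =>
      have := hw u v he
      simp [edgeExp, wt_single, this]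

/-- pull back weights: depends only on coordinates -/
lemma wt_congr {V : Type*} (w : V → ℤ) (x y : V) (hxy : x ≠ y) (p p' : V →₀ ℕ)
    (h : ∀ v, v ≠ x → v ≠ y → p v = p' v) :
    wt w p - wt w p' = w x * ((p x : ℤ) - p' x) + w y * ((p y : ℤ) - p' y) := by
  have key : ∀ q : V →₀ ℕ, ∀ s : Finset V, q.support ⊆ s → wt w q = ∑ v ∈ s, w v * (q v : ℤ) := by
    intro q s hs
    have : wt w q = q.sum fun v n => w v * (n : ℤ) := by
      rfl
    rw [this, Finsupp.sum_of_support_subset _ hs]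
    simp
  let s := p.support ∪ p'.support ∪ {x, y}
  rw [key p s (by intro v; simp [s]; tauto), key p' s (by intro v; simp [s]; tauto),
    ← Finset.sum_sub_distrib]
  have hs : ({x, y} : Finset V) ⊆ s := by intro v; simp [s]; tauto
  rw [← Finset.sum_subset hs, Finset.sum_pair hxy]
  · ring
  · intro v _ hv
    simp only [Finset.mem_insert, Finset.mem_singleton, not_or] at hv
    rw [h v hv.1 hv.2]; ring

lemma sep {V : Type*} (S₁ S₂ : Set V) (x y : V) (hxy : x ≠ y)
    (hx1 : x ∈ S₁) (hy1 : y ∈ S₁) (hx2 : x ∈ S₂) (hy2 : y ∈ S₂)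
    (hcap : ∀ v, v ∈ S₁ → v ∈ S₂ → v = x ∨ v = y)
    (G₁ : SimpleGraph S₁) (G₂ : SimpleGraph S₂) (w₁ : S₁ → ℤ) (w₂ : S₂ → ℤ)
    (hw1 : ∀ u v, G₁.Adj u v → w₁ u + w₁ v = 0)
    (hw2 : ∀ u v, G₂.Adj u v → w₂ u + w₂ v = 0)
    (h1x : w₁ ⟨x, hx1⟩ = -1) (h1y : w₁ ⟨y, hy1⟩ = -1)
    (h2x : w₂ ⟨x, hx2⟩ = -1) (h2y : w₂ ⟨y, hy2⟩ = 1)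
    (a a' : G₁.edgeSet →₀ ℕ) (b b' : G₂.edgeSet →₀ ℕ)
    (h : (degMap G₁ a).mapDomain Subtype.val + (degMap G₂ b).mapDomain Subtype.val =
      (degMap G₁ a').mapDomain Subtype.val + (degMap G₂ b').mapDomain (Subtype.val : S₂ → V)) :
    degMap G₁ a = degMap G₁ a' ∧ degMap G₂ b = degMap G₂ b' := by
  have ha := wt_degMap G₁ w₁ hw1 a
  have ha' := wt_degMap G₁ w₁ hw1 a'
  have hb := wt_degMap G₂ w₂ hw2 b
  have hb' := wt_degMap G₂ w₂ hw2 b'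
  generalize degMap G₁ a = p at *
  generalize degMap G₁ a' = p' at *
  generalize degMap G₂ b = q at *
  generalize degMap G₂ b' = q' at *
  have in1 : ∀ (p : S₁ →₀ ℕ) (v : V) (hv : v ∈ S₁), p.mapDomain Subtype.val v = p ⟨v, hv⟩ :=
    fun p v hv => Finsupp.mapDomain_apply Subtype.val_injective p ⟨v, hv⟩
  have in2 : ∀ (p : S₂ →₀ ℕ) (v : V) (hv : v ∈ S₂), p.mapDomain Subtype.val v = p ⟨v, hv⟩ :=
    fun p v hv => Finsupp.mapDomain_apply Subtype.val_injective p ⟨v, hv⟩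
  have out1 : ∀ (p : S₁ →₀ ℕ) (v : V) (hv : v ∉ S₁), p.mapDomain Subtype.val v = 0 :=
    fun p v hv => Finsupp.mapDomain_of_notMem_range _ _ (by simpa using hv)
  have out2 : ∀ (p : S₂ →₀ ℕ) (v : V) (hv : v ∉ S₂), p.mapDomain Subtype.val v = 0 :=
    fun p v hv => Finsupp.mapDomain_of_notMem_range _ _ (by simpa using hv)
  have hv : ∀ v, p.mapDomain Subtype.val v + q.mapDomain Subtype.val v =
      p'.mapDomain Subtype.val v + q'.mapDomain Subtype.val v := fun v => DFunLike.congr_fun h v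
  have P : ∀ v : S₁, v ≠ ⟨x, hx1⟩ → v ≠ ⟨y, hy1⟩ → p v = p' v := by
    rintro ⟨v, hv1⟩ n1 n2
    have hv2 : v ∉ S₂ := fun hv2 => by
      rcases hcap v hv1 hv2 with rfl | rfl
      · exact n1 rfl
      · exact n2 rfl
    simpa [in1 _ v hv1, out2 _ v hv2] using hv v
  have Q : ∀ v : S₂, v ≠ ⟨x, hx2⟩ → v ≠ ⟨y, hy2⟩ → q v = q' v := by
    rintro ⟨v, hv2⟩ n1 n2
    have hv1 : v ∉ S₁ := fun hv1 => by
      rcases hcap v hv1 hv2 with rfl | rfl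
      · exact n1 rfl
      · exact n2 rfl
    simpa [in2 _ v hv2, out1 _ v hv1] using hv v
  have e1 := wt_congr w₁ ⟨x, hx1⟩ ⟨y, hy1⟩ (by simpa using hxy) p p' P
  have e2 := wt_congr w₂ ⟨x, hx2⟩ ⟨y, hy2⟩ (by simpa using hxy) q q' Q
  have e3 := hv x
  have e4 := hv y
  rw [ha, ha', h1x, h1y] at e1
  rw [hb, hb', h2x, h2y] at e2
  rw [in1 _ x hx1, in1 _ x hx1, in2 _ x hx2, in2 _ x hx2] at e3
  rw [in1 _ y hy1, in1 _ y hy1, in2 _ y hy2, in2 _ y hy2] at e4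
  constructor
  · ext v
    by_cases n1 : v = ⟨x, hx1⟩
    · subst n1; omega
    by_cases n2 : v = ⟨y, hy1⟩
    · subst n2; omega
    exact P v n1 n2
  · ext v
    by_cases n1 : v = ⟨x, hx2⟩
    · subst n1; omega
    by_cases n2 : v = ⟨y, hy2⟩
    · subst n2; omega
    exact Q v n1 n2

open TensorProduct in
theorem decomp (K : Type*) [Field K] {V : Type*} (G : SimpleGraph V) (S₁ S₂ : Set V)
    (x y : V) (hxy : x ≠ y) (hnadj : ¬ G.Adj x y)
    (hx1 : x ∈ S₁) (hy1 : y ∈ S₁) (hx2 : x ∈ S₂) (hy2 : y ∈ S₂)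
    (hcap : ∀ v, v ∈ S₁ → v ∈ S₂ → v = x ∨ v = y)
    (hedge : ∀ u v, G.Adj u v → (u ∈ S₁ ∧ v ∈ S₁) ∨ (u ∈ S₂ ∧ v ∈ S₂))
    (w₁ w₂ : V → ℤ)
    (hw1 : ∀ u v, u ∈ S₁ → v ∈ S₁ → G.Adj u v → w₁ u + w₁ v = 0)
    (hw2 : ∀ u v, u ∈ S₂ → v ∈ S₂ → G.Adj u v → w₂ u + w₂ v = 0)
    (h1x : w₁ x = -1) (h1y : w₁ y = -1) (h2x : w₂ x = -1) (h2y : w₂ y = 1) :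
    toricIdeal K G =
        Ideal.map (rename (SimpleGraph.Hom.mapEdgeSet (SimpleGraph.Embedding.induce S₁).toHom) :
            MvPolynomial (G.induce S₁).edgeSet K →ₐ[K] MvPolynomial G.edgeSet K)
          (toricIdeal K (G.induce S₁)) ⊔
        Ideal.map (rename (SimpleGraph.Hom.mapEdgeSet (SimpleGraph.Embedding.induce S₂).toHom) :
            MvPolynomial (G.induce S₂).edgeSet K →ₐ[K] MvPolynomial G.edgeSet K)
          (toricIdeal K (G.induce S₂)) ∧
      Nonempty (edgeRing K G ≃ₐ[K]
        TensorProduct K (edgeRing K (G.induce S₁)) (edgeRing K (G.induce S₂))) := by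
  set G₁ := G.induce S₁ with hG₁
  set G₂ := G.induce S₂ with hG₂
  set r₁ : G₁.edgeSet → G.edgeSet := SimpleGraph.Hom.mapEdgeSet (SimpleGraph.Embedding.induce (G := G) S₁).toHom with hr₁
  set r₂ : G₂.edgeSet → G.edgeSet := SimpleGraph.Hom.mapEdgeSet (SimpleGraph.Embedding.induce (G := G) S₂).toHom with hr₂
  have v₁ : ∀ e, (r₁ e : Sym2 V) = Sym2.map Subtype.val (e : Sym2 S₁) := fun e => rfl
  have v₂ : ∀ e, (r₂ e : Sym2 V) = Sym2.map Subtype.val (e : Sym2 S₂) := fun e => rfl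
  have inj₁ : Function.Injective r₁ :=
    SimpleGraph.Hom.mapEdgeSet.injective _ Subtype.val_injective
  have inj₂ : Function.Injective r₂ :=
    SimpleGraph.Hom.mapEdgeSet.injective _ Subtype.val_injective
  have bij : Function.Bijective (Sum.elim r₁ r₂) := by
    constructor
    · refine Function.Injective.sumElim inj₁ inj₂ ?_
      rintro ⟨e, he⟩ ⟨f, hf⟩ h
      have h := congrArg Subtype.val h
      rw [v₁, v₂] at h
      induction e using Sym2.ind with
      | _ a b =>
      induction f using Sym2.ind with
      | _ c d =>
      have hab : G.Adj a.1 b.1 := he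
      have hba := hab.symm
      have hne := hab.ne
      obtain ⟨a, ha⟩ := a
      obtain ⟨b, hb⟩ := b
      obtain ⟨c, hc⟩ := c
      obtain ⟨d, hd⟩ := d
      simp only [Sym2.map_mk, Sym2.eq_iff] at h hab hba hne
      have hA : a ∈ S₂ ∧ b ∈ S₂ := by
        rcases h with ⟨rfl, rfl⟩ | ⟨rfl, rfl⟩
        · exact ⟨hc, hd⟩
        · exact ⟨hd, hc⟩
      rcases hcap a ha hA.1 with rfl | rfl <;> rcases hcap b hb hA.2 with rfl | rfl <;>
        simp_all
    · rintro ⟨e, he⟩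
      induction e using Sym2.ind with
      | _ a b =>
      rcases hedge a b he with ⟨ha, hb⟩ | ⟨ha, hb⟩
      · exact ⟨Sum.inl ⟨s(⟨a, ha⟩, ⟨b, hb⟩), he⟩, rfl⟩
      · exact ⟨Sum.inr ⟨s(⟨a, ha⟩, ⟨b, hb⟩), he⟩, rfl⟩
  let θ : MvPolynomial G₁.edgeSet K ⊗[K] MvPolynomial G₂.edgeSet K ≃ₐ[K]
      MvPolynomial G.edgeSet K :=
    (tensorEquivSum K G₁.edgeSet G₂.edgeSet K).trans (renameEquiv K (Equiv.ofBijective _ bij))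
  have θl : θ.toAlgHom.comp Algebra.TensorProduct.includeLeft = rename r₁ := by
    ext e : 1
    simp [θ]
  have θr : θ.toAlgHom.comp Algebra.TensorProduct.includeRight = rename r₂ := by
    ext e : 1
    simp [θ]
  have θlift : θ.toAlgHom = Algebra.TensorProduct.lift (rename r₁) (rename r₂)
      (fun _ _ => Commute.all _ _) := by
    apply Algebra.TensorProduct.ext
    · rw [θl, Algebra.TensorProduct.lift_comp_includeLeft]
    · ext e : 1
      have := DFunLike.congr_fun θr (X e)
      simpa using this
  have θt : ∀ p q, θ (p ⊗ₜ q) = rename r₁ p * rename r₂ q := fun p q => by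
    have := DFunLike.congr_fun θlift (p ⊗ₜ q)
    simpa using this
  -- compatibility of edge maps
  have c₁ : ∀ p, edgeHom K G (rename r₁ p) = rename Subtype.val (edgeHom K G₁ p) := by
    intro p
    have : (edgeHom K G).comp (rename r₁) = (rename Subtype.val).comp (edgeHom K G₁) := by
      ext e : 1
      obtain ⟨e, he⟩ := e
      induction e using Sym2.ind with
      | _ a b => simp [edgeHom, v₁, edgeMon]
    exact DFunLike.congr_fun this p
  have c₂ : ∀ p, edgeHom K G (rename r₂ p) = rename Subtype.val (edgeHom K G₂ p) := by
    intro p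
    have : (edgeHom K G).comp (rename r₂) = (rename Subtype.val).comp (edgeHom K G₂) := by
      ext e : 1
      obtain ⟨e, he⟩ := e
      induction e using Sym2.ind with
      | _ a b => simp [edgeHom, v₂, edgeMon]
    exact DFunLike.congr_fun this p
  let Φ := Algebra.TensorProduct.map (edgeHom K G₁) (edgeHom K G₂)
  let φ := (edgeHom K G).comp θ.toAlgHom
  let ρ : MvPolynomial S₁ K ⊗[K] MvPolynomial S₂ K →ₐ[K] MvPolynomial V K :=
    Algebra.TensorProduct.lift (rename Subtype.val) (rename Subtype.val)
      (fun _ _ => Commute.all _ _)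
  have hρ : ∀ t, φ t = ρ (Φ t) := by
    intro t
    induction t with
    | zero => simp
    | add a b ha hb => simp only [map_add, ha, hb]
    | tmul p q => simp [φ, ρ, Φ, θt, c₁, c₂]
  -- the separating linear map
  let D : (G₁.edgeSet →₀ ℕ) × (G₂.edgeSet →₀ ℕ) → (V →₀ ℕ) := fun z =>
    (degMap G₁ z.1).mapDomain Subtype.val + (degMap G₂ z.2).mapDomain Subtype.val
  let L : MvPolynomial V K →ₗ[K] MvPolynomial S₁ K ⊗[K] MvPolynomial S₂ K :=
    (basisMonomials V K).constr K (fun α =>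
      if h : ∃ z, D z = α then
        monomial (degMap G₁ h.choose.1) 1 ⊗ₜ monomial (degMap G₂ h.choose.2) 1 else 0)
  have hL : ∀ z, L (monomial (D z) 1) =
      monomial (degMap G₁ z.1) 1 ⊗ₜ monomial (degMap G₂ z.2) 1 := by
    intro z
    have hex : ∃ z', D z' = D z := ⟨z, rfl⟩
    have hb : monomial (D z) (1 : K) = basisMonomials V K (D z) := by
      rw [coe_basisMonomials]
    rw [hb]
    refine ((basisMonomials V K).constr_basis K _ (D z)).trans ?_
    rw [dif_pos hex]
    obtain ⟨h1, h2⟩ := sep S₁ S₂ x y hxy hx1 hy1 hx2 hy2 hcap G₁ G₂ (fun v => w₁ v) (fun v => w₂ v)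
      (fun u v h => hw1 u v u.2 v.2 h) (fun u v h => hw2 u v u.2 v.2 h) h1x h1y h2x h2y
      _ _ _ _ hex.choose_spec
    rw [h1, h2]
  have hLΦ : ∀ t, L (φ t) = Φ t := by
    intro t
    have : L ∘ₗ φ.toLinearMap = Φ.toLinearMap := by
      refine (Module.Basis.tensorProduct (basisMonomials G₁.edgeSet K)
        (basisMonomials G₂.edgeSet K)).ext ?_
      rintro ⟨a, b⟩
      have e1 : φ (monomial a 1 ⊗ₜ monomial b 1) = monomial (D (a, b)) 1 := by
        have : φ (monomial a 1 ⊗ₜ monomial b 1) =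
            edgeHom K G (θ (monomial a 1 ⊗ₜ monomial b 1)) := rfl
        rw [this, θt, map_mul, c₁, c₂, edgeHom_monomial, edgeHom_monomial, rename_monomial,
          rename_monomial, monomial_mul, one_mul]
      simp only [Module.Basis.tensorProduct_apply, coe_basisMonomials, LinearMap.comp_apply,
        AlgHom.toLinearMap_apply, e1, hL]
      simp [Φ, edgeHom_monomial]
    exact LinearMap.congr_fun this t
  have kerφ : ∀ t, φ t = 0 ↔ Φ t = 0 := fun t =>
    ⟨fun h => by rw [← hLΦ, h, map_zero], fun h => by rw [hρ, h, map_zero]⟩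
  -- quotient map
  let π := Algebra.TensorProduct.map (Ideal.Quotient.mkₐ K (toricIdeal K G₁))
    (Ideal.Quotient.mkₐ K (toricIdeal K G₂))
  have πs : Function.Surjective π :=
    TensorProduct.map_surjective (Ideal.Quotient.mkₐ_surjective K _)
      (Ideal.Quotient.mkₐ_surjective K _)
  let j₁ : edgeRing K G₁ →ₐ[K] MvPolynomial S₁ K := Ideal.kerLiftAlg (edgeHom K G₁)
  let j₂ : edgeRing K G₂ →ₐ[K] MvPolynomial S₂ K := Ideal.kerLiftAlg (edgeHom K G₂)
  have ji₁ : Function.Injective j₁ := Ideal.kerLiftAlg_injective (edgeHom K G₁)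
  have ji₂ : Function.Injective j₂ := Ideal.kerLiftAlg_injective (edgeHom K G₂)
  have ji : Function.Injective (Algebra.TensorProduct.map j₁ j₂) :=
    TensorProduct.map_injective_of_flat_flat j₁.toLinearMap j₂.toLinearMap ji₁ ji₂
  have hj : ∀ t, Φ t = Algebra.TensorProduct.map j₁ j₂ (π t) := by
    intro t
    induction t with
    | zero => simp
    | add a b ha hb => simp only [map_add, ha, hb]
    | tmul p q =>
      simp only [Φ, π, Algebra.TensorProduct.map_tmul]
      rfl
  have kerπ : ∀ t, φ t = 0 ↔ π t = 0 := fun t => by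
    rw [kerφ, hj, map_eq_zero_iff _ ji]
  have hker : RingHom.ker π = (toricIdeal K G₁).map
      (Algebra.TensorProduct.includeLeft : _ →ₐ[K]
        MvPolynomial G₁.edgeSet K ⊗[K] MvPolynomial G₂.edgeSet K) ⊔ (toricIdeal K G₂).map
      (Algebra.TensorProduct.includeRight : _ →ₐ[K]
        MvPolynomial G₁.edgeSet K ⊗[K] MvPolynomial G₂.edgeSet K) := by
    have := Algebra.TensorProduct.map_ker (Ideal.Quotient.mkₐ K (toricIdeal K G₁))
      (Ideal.Quotient.mkₐ K (toricIdeal K G₂)) (Ideal.Quotient.mkₐ_surjective K _)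
      (Ideal.Quotient.mkₐ_surjective K _)
    have k₁ : RingHom.ker (Ideal.Quotient.mkₐ K (toricIdeal K G₁)) = toricIdeal K G₁ :=
      Ideal.mk_ker
    have k₂ : RingHom.ker (Ideal.Quotient.mkₐ K (toricIdeal K G₂)) = toricIdeal K G₂ :=
      Ideal.mk_ker
    rwa [k₁, k₂] at this
  have hmap : toricIdeal K G = (RingHom.ker π).map (θ : _ →ₐ[K] MvPolynomial G.edgeSet K) := by
    have hc : RingHom.ker π = (toricIdeal K G).comap (θ : _ →ₐ[K] MvPolynomial G.edgeSet K) := by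
      ext t
      exact (kerπ t).symm
    rw [hc, Ideal.map_comap_of_surjective θ.toAlgHom θ.surjective]
  refine ⟨?_, ⟨?_⟩⟩
  · rw [hmap, hker, Ideal.map_sup, ← θl, ← θr]
    congr 1
    · exact Ideal.map_map (I := toricIdeal K G₁) _ _
    · exact Ideal.map_map (I := toricIdeal K G₂) _ _
  · exact (Ideal.quotientEquivAlg (RingHom.ker π) (toricIdeal K G) θ hmap).symm.trans
      (Ideal.quotientKerAlgEquivOfSurjective πs)

/-- Decomposition of the toric ideal of a mixed-type multi-path graph. -/
theorem statement0 (K : Type*) [Field K] (m s : ℕ) (hm : 2 ≤ m) (hs1 : 1 ≤ s) (hsm : s < m)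
    (ℓ : Fin m → ℕ)
    (heven : ∀ i : Fin m, (i : ℕ) < s → Even (ℓ i) ∧ 2 ≤ ℓ i)
    (hodd : ∀ i : Fin m, s ≤ (i : ℕ) → Odd (ℓ i) ∧ 3 ≤ ℓ i) :
    let c : Fin m → ℕ := fun i => ℓ i - 1
    let G := multiPath c
    let S₁ : Set (MPV c) :=
      {x | x = Sum.inl 0 ∨ x = Sum.inl 1 ∨ ∃ (i : Fin m) (j : Fin (c i)), (i : ℕ) < s ∧ x = Sum.inr ⟨i, j⟩}
    let S₂ : Set (MPV c) :=
      {x | x = Sum.inl 0 ∨ x = Sum.inl 1 ∨ ∃ (i : Fin m) (j : Fin (c i)), s ≤ (i : ℕ) ∧ x = Sum.inr ⟨i, j⟩}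
    toricIdeal K G =
        Ideal.map (rename (SimpleGraph.Hom.mapEdgeSet (SimpleGraph.Embedding.induce S₁).toHom) :
            MvPolynomial (G.induce S₁).edgeSet K →ₐ[K] MvPolynomial G.edgeSet K)
          (toricIdeal K (G.induce S₁)) ⊔
        Ideal.map (rename (SimpleGraph.Hom.mapEdgeSet (SimpleGraph.Embedding.induce S₂).toHom) :
            MvPolynomial (G.induce S₂).edgeSet K →ₐ[K] MvPolynomial G.edgeSet K)
          (toricIdeal K (G.induce S₂)) ∧
      Nonempty (edgeRing K G ≃ₐ[K]
        TensorProduct K (edgeRing K (G.induce S₁)) (edgeRing K (G.induce S₂))) := by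
  intro c G S₁ S₂
  have hc1 : ∀ i : Fin m, (i : ℕ) < s → c i % 2 = 1 := by
    intro i hi
    obtain ⟨⟨k, hk⟩, h2⟩ := heven i hi
    simp only [c]; omega
  have hc2 : ∀ i : Fin m, s ≤ (i : ℕ) → c i % 2 = 0 := by
    intro i hi
    obtain ⟨⟨k, hk⟩, h2⟩ := hodd i hi
    simp only [c]; omega
  have par : ∀ n : ℕ, (n % 2 = 0 → (-1 : ℤ) ^ n = 1) ∧ (n % 2 = 1 → (-1 : ℤ) ^ n = -1) :=
    fun n => ⟨fun h => (Nat.even_iff.2 h).neg_one_pow, fun h => (Nat.odd_iff.2 h).neg_one_pow⟩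
  let w : ℤ → MPV c → ℤ := fun ε v => match v with
    | Sum.inl a => if a = 0 then -1 else ε
    | Sum.inr ⟨_, j⟩ => (-1) ^ (j : ℕ)
  have m1 : ∀ i j, (Sum.inr ⟨i, j⟩ : MPV c) ∈ S₁ ↔ (i : ℕ) < s := by
    intro i j
    constructor
    · rintro (h | h | ⟨i', j', h, h'⟩)
      · cases h
      · cases h
      · cases h'; exact h
    · intro h; exact Or.inr (Or.inr ⟨i, j, h, rfl⟩)
  have m2 : ∀ i j, (Sum.inr ⟨i, j⟩ : MPV c) ∈ S₂ ↔ s ≤ (i : ℕ) := by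
    intro i j
    constructor
    · rintro (h | h | ⟨i', j', h, h'⟩)
      · cases h
      · cases h
      · cases h'; exact h
    · intro h; exact Or.inr (Or.inr ⟨i, j, h, rfl⟩)
  have n1 : ∀ a, (Sum.inl a : MPV c) ∈ S₁ := by
    intro a; fin_cases a
    · exact Or.inl rfl
    · exact Or.inr (Or.inl rfl)
  have n2 : ∀ a, (Sum.inl a : MPV c) ∈ S₂ := by
    intro a; fin_cases a
    · exact Or.inl rfl
    · exact Or.inr (Or.inl rfl)
  have R1 : ∀ u v, mpRel c u v → u ∈ S₁ → v ∈ S₁ → w (-1) u + w (-1) v = 0 := by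
    rintro (a | ⟨i, j⟩) (b | ⟨i', j'⟩) h hu hv
    · exact h.elim
    · rw [m1] at hv
      have := hc1 i' hv
      rcases h with ⟨rfl, h⟩ | ⟨rfl, h⟩
      · simp [w, h]
      · have := (par j').1 (by omega)
        simp [w, this]
    · exact h.elim
    · obtain ⟨_, h⟩ := h
      simp [w, h, pow_succ]
  have R2 : ∀ u v, mpRel c u v → u ∈ S₂ → v ∈ S₂ → w 1 u + w 1 v = 0 := by
    rintro (a | ⟨i, j⟩) (b | ⟨i', j'⟩) h hu hv
    · exact h.elim
    · rw [m2] at hv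
      have := hc2 i' hv
      rcases h with ⟨rfl, h⟩ | ⟨rfl, h⟩
      · simp [w, h]
      · have := (par j').2 (by omega)
        simp [w, this]
    · exact h.elim
    · obtain ⟨_, h⟩ := h
      simp [w, h, pow_succ]
  have E : ∀ u v, mpRel c u v → (u ∈ S₁ ∧ v ∈ S₁) ∨ (u ∈ S₂ ∧ v ∈ S₂) := by
    rintro (a | ⟨i, j⟩) (b | ⟨i', j'⟩) h
    · exact h.elim
    · rw [m1, m2]
      rcases lt_or_ge (i' : ℕ) s with h | h
      · exact Or.inl ⟨n1 a, h⟩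
      · exact Or.inr ⟨n2 a, h⟩
    · exact h.elim
    · obtain ⟨h, _⟩ := h
      rw [m1, m2, m1, m2]
      omega
  refine decomp K G S₁ S₂ (Sum.inl 0) (Sum.inl 1) (by simp) ?_ (n1 _) (n1 _) (n2 _) (n2 _) ?_ ?_
    (w (-1)) (w 1) ?_ ?_ (by simp [w]) (by simp [w]) (by simp [w]) (by simp [w])
  · rintro ⟨_, h | h⟩ <;> exact h
  · rintro (a | ⟨i, j⟩) h1 h2
    · fin_cases a
      · exact Or.inl rfl
      · exact Or.inr rfl
    · rw [m1] at h1; rw [m2] at h2; omega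
  · rintro u v ⟨_, h | h⟩
    · exact E u v h
    · have := E v u h; tauto
  · rintro u v hu hv ⟨_, h | h⟩
    · exact R1 u v h hu hv
    · rw [add_comm]; exact R1 v u h hv hu
  · rintro u v hu hv ⟨_, h | h⟩
    · exact R2 u v h hu hv
    · rw [add_comm]; exact R2 v u h hv hu

end Paper
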